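/- Let F ⊂ ℝ^p be compact and 0 < α ≤ 1. Then there exists a dense G_δ subset 𝒢 of C₁^α(F) such that for every f ∈ 𝒢, D_*^f(F) = D_*(α, F). -/

import Mathlib

open Set Metric MeasureTheory Filter

noncomputable section

abbrev Euc (p : ℕ) := EuclideanSpace ℝ (Fin p)

/-- The space `C₁^α(F)` of 1-Hölder-α functions on `F`, with the supremum metric. -/
def HolderBall (p : ℕ) (α : ℝ) (F : Set (Euc p)) :=
  {f : BoundedContinuousFunction ↥F ℝ // ∀ x y : ↥F, |f x - f y| ≤ dist x y ^ α}

instance (p : ℕ) (α : ℝ) (F : Set (Euc p)) : MetricSpace (HolderBall p α F) :=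
  inferInstanceAs (MetricSpace
    {f : BoundedContinuousFunction ↥F ℝ // ∀ x y : ↥F, |f x - f y| ≤ dist x y ^ α})

/-- `D_*^f(A) = sup{d : λ{r : dim_H (f⁻¹(r) ∩ A) ≥ d} > 0}`. -/
def DstarOn {p : ℕ} {F : Set (Euc p)} (f : ↥F → ℝ) (A : Set ↥F) : ℝ :=
  sSup {d : ℝ | 0 < volume {r : ℝ | ENNReal.ofReal d ≤ dimH (f ⁻¹' {r} ∩ A)}}

/-- `D_*(α, F)`: the sup over dense `G_δ` subsets `𝒢` of `C₁^α(F)` of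
`inf{D_*^f : f ∈ 𝒢}`. -/
def DstarAlpha (p : ℕ) (α : ℝ) (F : Set (Euc p)) : ℝ :=
  sSup {v : ℝ | ∃ G : Set (HolderBall p α F), Dense G ∧ IsGδ G ∧
    v = sInf ((fun f : HolderBall p α F =>
      DstarOn (fun x : ↥F => f.1 x) Set.univ) '' G)}

open scoped NNReal ENNReal Topology

/-- Every countable open cover of `E` has `s`-sum at least `c`. -/
def LargeContent {X : Type*} [MetricSpace X] (s : ℝ≥0) (c : ℝ≥0∞) (E : Set X) : Prop :=
  ∀ t : ℕ → Set X, (∀ n, IsOpen (t n)) → E ⊆ ⋃ n, t n → c ≤ ∑' n, ediam (t n) ^ (s : ℝ)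

lemma dimH_le_of_small {X : Type*} [MetricSpace X] {s : ℝ≥0} (hs : 0 < s) {E : Set X}
    (h : ∀ n : ℕ, ¬ LargeContent s ((n : ℝ≥0∞) + 1)⁻¹ E) : dimH E ≤ s := by
  borelize X
  apply dimH_le_of_hausdorffMeasure_ne_top
  have hs' : (0 : ℝ) < s := by exact_mod_cast hs
  simp only [LargeContent, not_forall, not_le] at h
  choose t ht hE hsum using h
  have h0 : Tendsto (fun n : ℕ => ((n : ℝ≥0∞) + 1)⁻¹) atTop (𝓝 0) := by
    have := (tendsto_add_atTop_iff_nat 1).2 ENNReal.tendsto_inv_nat_nhds_zero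
    simpa using this
  have h1 : Tendsto (fun n : ℕ => (((n : ℝ≥0∞) + 1)⁻¹) ^ ((s : ℝ)⁻¹)) atTop (𝓝 0) := by
    have := (ENNReal.continuous_rpow_const (y := (s : ℝ)⁻¹)).tendsto 0
    rw [ENNReal.zero_rpow_of_pos (inv_pos.2 hs')] at this
    exact this.comp h0
  have key := Measure.hausdorffMeasure_le_liminf_tsum (s : ℝ) E (l := atTop) _ h1 t
    (Eventually.of_forall fun n i => by
      rw [ENNReal.le_rpow_inv_iff hs']
      exact (ENNReal.le_tsum i).trans (hsum n).le) (Eventually.of_forall hE)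
  have h2 : liminf (fun n => ∑' i, ediam (t n i) ^ (s : ℝ)) atTop = 0 := by
    refine Tendsto.liminf_eq ?_
    exact tendsto_of_tendsto_of_tendsto_of_le_of_le tendsto_const_nhds h0
      (fun _ => zero_le) (fun n => (hsum n).le)
  rw [h2] at key
  exact (lt_of_le_of_lt key (by simp)).ne

lemma le_dimH_of_large {X : Type*} [MetricSpace X] {s : ℝ≥0} (hs : 0 < s) {E : Set X}
    {c : ℝ≥0∞} (hc : 0 < c) (h : LargeContent s c E) : (s : ℝ≥0∞) ≤ dimH E := by
  borelize X
  have hs' : (0 : ℝ) < s := by exact_mod_cast hs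
  by_contra hlt
  have h0 := hausdorffMeasure_of_dimH_lt (not_le.1 hlt)
  rw [Measure.hausdorffMeasure_apply] at h0
  have h1 := (iSup₂_le_iff.1 h0.le) 1 one_pos
  have hc2 : 0 < c / 2 := ENNReal.half_pos hc.ne'
  have h2 := lt_of_le_of_lt h1 hc2
  simp only [iInf_lt_iff] at h2
  obtain ⟨t, htE, htd, hsum⟩ := h2
  obtain ⟨ε, εpos, hε⟩ := ENNReal.exists_pos_sum_of_countable' hc2.ne' ℕ
  have hu : ∀ n, ∃ u : Set X, IsOpen u ∧ t n ⊆ u ∧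
      ediam u ^ (s : ℝ) ≤ (⨆ _ : (t n).Nonempty, ediam (t n) ^ (s : ℝ)) + ε n := by
    intro n
    rcases (t n).eq_empty_or_nonempty with he | hne
    · exact ⟨∅, isOpen_empty, he.le, by simp [ENNReal.zero_rpow_of_pos hs']⟩
    · have hfin : ediam (t n) ^ (s : ℝ) ≠ ∞ :=
        ENNReal.rpow_ne_top_of_nonneg hs'.le (ne_top_of_le_ne_top (by simp) (htd n))
      have hcont : Tendsto (fun δ : ℝ≥0 => (ediam (t n) + 2 * (δ : ℝ≥0∞)) ^ (s : ℝ)) (𝓝 0)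
          (𝓝 (ediam (t n) ^ (s : ℝ))) := by
        have : Tendsto (fun δ : ℝ≥0 => ediam (t n) + 2 * (δ : ℝ≥0∞)) (𝓝 0)
            (𝓝 (ediam (t n) + 2 * ((0 : ℝ≥0) : ℝ≥0∞))) :=
          tendsto_const_nhds.add (ENNReal.Tendsto.const_mul
            (ENNReal.tendsto_coe.2 tendsto_id) (Or.inr (by simp)))
        have h3 := (ENNReal.continuous_rpow_const (y := (s : ℝ))).tendsto
          (ediam (t n) + 2 * ((0 : ℝ≥0) : ℝ≥0∞))
        have h4 := h3.comp this
        simpa [Function.comp_def] using h4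
      have hlt := hcont.eventually (gt_mem_nhds (ENNReal.lt_add_right hfin (εpos n).ne'))
      have hlt' : ∀ᶠ δ : ℝ≥0 in 𝓝[>] 0, (ediam (t n) + 2 * (δ : ℝ≥0∞)) ^ (s : ℝ) <
        ediam (t n) ^ (s : ℝ) + ε n := nhdsWithin_le_nhds hlt
      obtain ⟨δ, hδ, hδ0⟩ := (hlt'.and self_mem_nhdsWithin).exists
      refine ⟨thickening δ (t n), isOpen_thickening,
        self_subset_thickening (by exact_mod_cast hδ0) _, ?_⟩
      simp only [hne, iSup_pos]
      exact (ENNReal.rpow_le_rpow (ediam_thickening_le δ) hs'.le).trans hδ.le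
  choose u huo htu hud using hu
  have h5 := h u huo (htE.trans (iUnion_mono htu))
  have h6 : ∑' n, ediam (u n) ^ (s : ℝ) < c / 2 + c / 2 :=
    calc _ ≤ ∑' n, ((⨆ _ : (t n).Nonempty, ediam (t n) ^ (s : ℝ)) + ε n) :=
          ENNReal.tsum_le_tsum hud
      _ = _ := ENNReal.tsum_add
      _ < _ := ENNReal.add_lt_add hsum hε
  rw [ENNReal.add_halves] at h6
  exact absurd h5 (not_le.2 h6)

lemma isClosed_large {p : ℕ} {α : ℝ} {F : Set (Euc p)} (hF : IsCompact F) {A : Set ↥F}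
    (hA : IsClosed A) (s : ℝ≥0) {c : ℝ≥0∞} (hc : 0 < c) (hs : 0 < s) (δ : ℝ≥0∞) :
    IsClosed {f : HolderBall p α F |
      δ ≤ volume {r : ℝ | LargeContent s c ((fun x : ↥F => f.1 x) ⁻¹' {r} ∩ A)}} := by
  have hs' : (0 : ℝ) < s := by exact_mod_cast hs
  have : CompactSpace ↥F := isCompact_iff_compactSpace.1 hF
  rw [← isOpen_compl_iff, isOpen_iff_eventually]
  intro f hf
  simp only [mem_compl_iff, mem_ofPred_eq, not_le] at hf ⊢
  obtain ⟨W, hEW, hW, hWδ⟩ := exists_isOpen_lt_of_lt _ _ hf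
  have hval : Continuous (fun g : HolderBall p α F => g.1) := continuous_subtype_val
  have heval : Continuous (fun z : (HolderBall p α F × ℝ) × ↥F => z.1.1.1 z.2 - z.1.2) := by
    have h1 : Continuous (fun z : (HolderBall p α F × ℝ) × ↥F => z.1.1.1 z.2) :=
      continuous_eval.comp
        ((hval.comp (continuous_fst.comp continuous_fst)).prodMk continuous_snd)
    exact h1.sub (continuous_snd.comp continuous_fst)
  have hK : IsCompact (Icc (-(‖f.1‖ + 1)) (‖f.1‖ + 1) \ W) := isCompact_Icc.diff hW
  have h1 : ∀ᶠ g : HolderBall p α F in 𝓝 f, ∀ r ∈ Icc (-(‖f.1‖ + 1)) (‖f.1‖ + 1) \ W,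
      ¬ LargeContent s c ((fun x : ↥F => g.1 x) ⁻¹' {r} ∩ A) := by
    refine hK.eventually_forall_of_forall_eventually ?_
    intro r hr
    have hnot : ¬ LargeContent s c ((fun x : ↥F => f.1 x) ⁻¹' {r} ∩ A) := fun h => hr.2 (hEW h)
    simp only [LargeContent, not_forall, not_le] at hnot
    obtain ⟨t, hto, htE, hts⟩ := hnot
    have hV : IsOpen (⋃ n, t n) := isOpen_iUnion hto
    have h2 : ∀ᶠ z : HolderBall p α F × ℝ in 𝓝 (f, r), ∀ x ∈ A \ ⋃ n, t n,
        z.1.1 x - z.2 ≠ 0 := by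
      refine (hA.isCompact.diff hV).eventually_forall_of_forall_eventually ?_
      intro x hx
      refine heval.continuousAt.eventually_ne ?_
      intro h0
      exact hx.2 (htE ⟨sub_eq_zero.1 h0, hx.1⟩)
    filter_upwards [h2] with z hz hlarge
    refine absurd (hlarge t hto ?_) (not_le.2 hts)
    rintro x ⟨hx, hxA⟩
    by_contra hxt
    exact hz x ⟨hxA, hxt⟩ (sub_eq_zero.2 hx)
  have h2 : ∀ᶠ g : HolderBall p α F in 𝓝 f, ‖g.1‖ < ‖f.1‖ + 1 :=
    (hval.norm.tendsto f).eventually (gt_mem_nhds (by linarith))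
  filter_upwards [h1, h2] with g hg1 hg2
  refine lt_of_le_of_lt (measure_mono ?_) hWδ
  intro r hr
  by_contra hrW
  refine hg1 r ⟨?_, hrW⟩ hr
  by_contra hrI
  have he : (fun x : ↥F => g.1 x) ⁻¹' {r} ∩ A = ∅ := by
    rw [eq_empty_iff_forall_notMem]
    rintro x ⟨hx, -⟩
    have hx' : g.1 x = r := hx
    have := g.1.norm_coe_le_norm x
    rw [hx', Real.norm_eq_abs] at this
    exact hrI (abs_le.1 (this.trans hg2.le))
  have hr' : LargeContent s c ((fun x : ↥F => g.1 x) ⁻¹' {r} ∩ A) := hr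
  rw [he] at hr'
  have := hr' (fun _ => ∅) (fun _ => isOpen_empty) (empty_subset _)
  simp [ENNReal.zero_rpow_of_pos hs'] at this
  exact hc.ne' this

lemma dimH_le_p {p : ℕ} {F : Set (Euc p)} (E : Set ↥F) : dimH E ≤ p := by
  rw [← isometry_subtype_coe.dimH_image E]
  refine (dimH_mono (subset_univ _)).trans ?_
  rw [Real.dimH_univ_eq_finrank]
  simp

lemma bdd_Dset {p : ℕ} {F : Set (Euc p)} (f : ↥F → ℝ) (A : Set ↥F) :
    (p : ℝ) ∈ upperBounds
      {d : ℝ | 0 < volume {r : ℝ | ENNReal.ofReal d ≤ dimH (f ⁻¹' {r} ∩ A)}} := by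
  intro d hd
  obtain ⟨r, hr⟩ := nonempty_of_measure_ne_zero (ne_of_gt hd)
  have := le_trans hr (dimH_le_p _)
  by_contra hlt
  rw [not_le] at hlt
  have h2 : ENNReal.ofReal d ≤ ENNReal.ofReal p := by simpa using this
  rw [ENNReal.ofReal_le_ofReal_iff (by positivity)] at h2
  linarith

lemma zero_mem_Dset {p : ℕ} {F : Set (Euc p)} (f : ↥F → ℝ) (A : Set ↥F) :
    (0 : ℝ) ∈ {d : ℝ | 0 < volume {r : ℝ | ENNReal.ofReal d ≤ dimH (f ⁻¹' {r} ∩ A)}} := by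
  simp

lemma Dstar_nonneg {p : ℕ} {F : Set (Euc p)} (f : ↥F → ℝ) (A : Set ↥F) : 0 ≤ DstarOn f A :=
  le_csSup ⟨_, bdd_Dset f A⟩ (zero_mem_Dset f A)

lemma Dstar_le {p : ℕ} {F : Set (Euc p)} (f : ↥F → ℝ) (A : Set ↥F) : DstarOn f A ≤ p :=
  csSup_le ⟨_, zero_mem_Dset f A⟩ (bdd_Dset f A)

lemma lt_Dstar_iff {p : ℕ} {F : Set (Euc p)} (f : ↥F → ℝ) (A : Set ↥F) (d : ℝ) :
    d < DstarOn f A ↔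
      ∃ d' > d, 0 < volume {r : ℝ | ENNReal.ofReal d' ≤ dimH (f ⁻¹' {r} ∩ A)} := by
  constructor
  · intro h
    obtain ⟨d', h1, h2⟩ := exists_lt_of_lt_csSup ⟨_, zero_mem_Dset f A⟩ h
    exact ⟨d', h2, h1⟩
  · rintro ⟨d', h1, h2⟩
    exact lt_of_lt_of_le h1 (le_csSup ⟨_, bdd_Dset f A⟩ h2)

/-- The exponents used to describe `d < DstarOn f A`. -/
def sk (d : ℝ) (k : ℕ) : ℝ≥0 := d.toNNReal + ((k : ℝ≥0) + 1)⁻¹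

lemma lt_Dstar_iff' {p : ℕ} {F : Set (Euc p)} (f : ↥F → ℝ) (A : Set ↥F) {d : ℝ} (hd : 0 ≤ d) :
    d < DstarOn f A ↔ ∃ i : ℕ × ℕ × ℕ, ((i.2.2 : ℝ≥0∞) + 1)⁻¹ ≤
      volume {r : ℝ | LargeContent (sk d i.1) ((i.2.1 : ℝ≥0∞) + 1)⁻¹ (f ⁻¹' {r} ∩ A)} := by
  have hsk : ∀ k, 0 < sk d k := fun k => by unfold sk; positivity
  have hskd : ∀ k, (sk d k : ℝ) = d + ((k : ℝ) + 1)⁻¹ := fun k => by simp [sk, hd]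
  rw [lt_Dstar_iff]
  constructor
  · rintro ⟨d', hdd', hpos⟩
    obtain ⟨k, hk⟩ := exists_nat_one_div_lt (sub_pos.2 hdd')
    have hkd' : (sk d k : ℝ) < d' := by rw [hskd]; rw [one_div] at hk; linarith
    have hsub : {r : ℝ | ENNReal.ofReal d' ≤ dimH (f ⁻¹' {r} ∩ A)} ⊆
        ⋃ n : ℕ, {r : ℝ | LargeContent (sk d k) ((n : ℝ≥0∞) + 1)⁻¹ (f ⁻¹' {r} ∩ A)} := by
      intro r hr
      by_contra hno
      simp only [mem_iUnion, mem_ofPred_eq, not_exists] at hno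
      have h1 := le_trans hr (dimH_le_of_small (hsk k) hno)
      rw [← ENNReal.ofReal_coe_nnreal, ENNReal.ofReal_le_ofReal_iff (by positivity)] at h1
      linarith
    have h2 : volume (⋃ n : ℕ,
        {r : ℝ | LargeContent (sk d k) ((n : ℝ≥0∞) + 1)⁻¹ (f ⁻¹' {r} ∩ A)}) ≠ 0 :=
      (lt_of_lt_of_le hpos (measure_mono hsub)).ne'
    rw [Ne, measure_iUnion_null_iff, not_forall] at h2
    obtain ⟨n, hn⟩ := h2
    obtain ⟨m, hm⟩ := ENNReal.exists_inv_nat_lt hn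
    refine ⟨(k, n, m), le_trans ?_ hm.le⟩
    exact ENNReal.inv_le_inv.2 le_self_add
  · rintro ⟨⟨k, n, m⟩, h⟩
    refine ⟨sk d k, ?_, ?_⟩
    · rw [hskd]
      have : 0 < ((k : ℝ) + 1)⁻¹ := by positivity
      linarith
    · refine lt_of_lt_of_le ?_ (h.trans (measure_mono ?_))
      · simp
      · intro r hr
        rw [mem_ofPred_eq, ENNReal.ofReal_coe_nnreal]
        exact le_dimH_of_large (hsk k) (by simp) hr

/-- The closed pieces. -/
def CP (p : ℕ) (α : ℝ) (F : Set (Euc p)) (A : Set ↥F) (d : ℝ) (i : ℕ × ℕ × ℕ) :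
    Set (HolderBall p α F) :=
  {f | ((i.2.2 : ℝ≥0∞) + 1)⁻¹ ≤ volume {r : ℝ |
    LargeContent (sk d i.1) ((i.2.1 : ℝ≥0∞) + 1)⁻¹ ((fun x : ↥F => f.1 x) ⁻¹' {r} ∩ A)}}

lemma CP_closed {p : ℕ} {α : ℝ} {F : Set (Euc p)} (hF : IsCompact F) {A : Set ↥F}
    (hA : IsClosed A) (d : ℝ) (i : ℕ × ℕ × ℕ) : IsClosed (CP p α F A d i) :=
  isClosed_large hF hA _ (by simp) (by unfold sk; positivity) _

lemma mem_CP {p : ℕ} {α : ℝ} {F : Set (Euc p)} {A : Set ↥F} {d : ℝ} (hd : 0 ≤ d)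
    (f : HolderBall p α F) :
    d < DstarOn (fun x : ↥F => f.1 x) A ↔ ∃ i, f ∈ CP p α F A d i :=
  lt_Dstar_iff' _ A hd

instance (p : ℕ) (α : ℝ) (F : Set (Euc p)) : CompleteSpace (HolderBall p α F) := by
  have : IsClosed {f : BoundedContinuousFunction ↥F ℝ |
      ∀ x y : ↥F, |f x - f y| ≤ dist x y ^ α} := by
    simp only [ofPred_forall]
    refine isClosed_iInter fun x => isClosed_iInter fun y => ?_
    refine isClosed_le ?_ continuous_const
    exact ((continuous_eval_const x).sub
      (continuous_eval_const y)).abs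
  exact this.completeSpace_coe

instance (p : ℕ) (α : ℝ) (F : Set (Euc p)) : Nonempty (HolderBall p α F) :=
  ⟨⟨0, fun x y => by simpa using Real.rpow_nonneg dist_nonneg α⟩⟩

lemma dist_holder {p : ℕ} {α : ℝ} {F : Set (Euc p)} (f g : HolderBall p α F) :
    dist f g = dist f.1 g.1 := rfl

/-- Adding a constant. -/
def shift {p : ℕ} {α : ℝ} {F : Set (Euc p)} (f : HolderBall p α F) (c : ℝ) : HolderBall p α F :=
  ⟨f.1 + BoundedContinuousFunction.const _ c, fun x y => by simpa using f.2 x y⟩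

lemma shift_apply {p : ℕ} {α : ℝ} {F : Set (Euc p)} (f : HolderBall p α F) (c : ℝ) (x : ↥F) :
    (shift f c).1 x = f.1 x + c := rfl

/-- Clamping `g` to the tube of radius `η` around `h`. -/
lemma exists_clamp {p : ℕ} {α : ℝ} {F : Set (Euc p)} (g h : HolderBall p α F) {A : Set ↥F}
    {η : ℝ} (hη : 0 ≤ η) (hA : ∀ x ∈ A, |g.1 x - h.1 x| ≤ η) :
    ∃ k : HolderBall p α F, (∀ x ∈ A, k.1 x = g.1 x) ∧ dist k h ≤ η := by
  refine ⟨⟨(shift h (-η)).1 ⊔ ((shift h η).1 ⊓ g.1), ?_⟩, ?_, ?_⟩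
  · intro x y
    have h1 := h.2 x y
    have h2 := g.2 x y
    change |max (h.1 x + -η) (min (h.1 x + η) (g.1 x)) -
      max (h.1 y + -η) (min (h.1 y + η) (g.1 y))| ≤ _
    refine (abs_max_sub_max_le_max _ _ _ _).trans (max_le ?_ ?_)
    · simpa using h1
    · refine (abs_min_sub_min_le_max _ _ _ _).trans (max_le ?_ h2)
      simpa using h1
  · intro x hx
    have h1 := abs_le.1 (hA x hx)
    change max (h.1 x + -η) (min (h.1 x + η) (g.1 x)) = _
    rw [min_eq_right (by linarith), max_eq_right (by linarith)]
  · refine (BoundedContinuousFunction.dist_le hη).2 ?_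
    intro x
    change |max (h.1 x + -η) (min (h.1 x + η) (g.1 x)) - h.1 x| ≤ η
    rw [abs_le]
    constructor
    · linarith [le_max_left (h.1 x + -η) (min (h.1 x + η) (g.1 x))]
    · have : max (h.1 x + -η) (min (h.1 x + η) (g.1 x)) ≤ h.1 x + η :=
        max_le (by linarith) (min_le_left _ _)
      linarith

/-- If `f₁ = f₂ + c` on `A`, both have the same `DstarOn A`. -/
lemma Dstar_translate {p : ℕ} {F : Set (Euc p)} (f₁ f₂ : ↥F → ℝ) (A : Set ↥F) (c : ℝ)
    (h : ∀ x ∈ A, f₁ x = f₂ x + c) : DstarOn f₁ A = DstarOn f₂ A := by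
  unfold DstarOn
  congr 1
  ext d
  have hE : {r : ℝ | ENNReal.ofReal d ≤ dimH (f₂ ⁻¹' {r} ∩ A)} =
      (fun r => r + c) ⁻¹' {r : ℝ | ENNReal.ofReal d ≤ dimH (f₁ ⁻¹' {r} ∩ A)} := by
    ext r
    have : f₁ ⁻¹' {r + c} ∩ A = f₂ ⁻¹' {r} ∩ A := by
      ext x
      simp only [mem_inter_iff, mem_preimage, mem_singleton_iff]
      refine and_congr_left fun hx => ?_
      rw [h x hx]
      simp
    simp only [mem_preimage, mem_ofPred_eq, this]
  simp only [mem_ofPred_eq, hE, measure_preimage_add_right]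

lemma Dstar_mono {p : ℕ} {F : Set (Euc p)} (f : ↥F → ℝ) (A : Set ↥F) :
    DstarOn f A ≤ DstarOn f univ := by
  refine csSup_le_csSup ⟨_, bdd_Dset f univ⟩ ⟨_, zero_mem_Dset f A⟩ ?_
  intro d hd
  rw [mem_ofPred_eq] at hd ⊢
  refine lt_of_lt_of_le hd (measure_mono ?_)
  intro r hr
  exact le_trans hr (dimH_mono (inter_subset_inter_right _ (subset_univ _)))

lemma Dstar_cover {p : ℕ} {F : Set (Euc p)} (f : ↥F → ℝ) {d : ℝ} (hd : 0 ≤ d)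
    {ι : Type*} [Countable ι] (A : ι → Set ↥F) (hA : ∀ x, ∃ i, x ∈ A i)
    (h : d < DstarOn f univ) : ∃ i, d < DstarOn f (A i) := by
  obtain ⟨d', hdd', hpos⟩ := (lt_Dstar_iff _ _ _).1 h
  obtain ⟨e, hde, hed'⟩ := exists_between hdd'
  have hsub : {r : ℝ | ENNReal.ofReal d' ≤ dimH (f ⁻¹' {r} ∩ univ)} ⊆
      ⋃ i, {r : ℝ | ENNReal.ofReal e ≤ dimH (f ⁻¹' {r} ∩ A i)} := by
    intro r hr
    have hun : f ⁻¹' {r} ∩ univ = ⋃ i, f ⁻¹' {r} ∩ A i := by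
      rw [← inter_iUnion, iUnion_eq_univ_iff.2 hA]
    rw [mem_ofPred_eq, hun, dimH_iUnion] at hr
    have h1 : ENNReal.ofReal e < ENNReal.ofReal d' :=
      (ENNReal.ofReal_lt_ofReal_iff (by linarith)).2 hed'
    obtain ⟨i, hi⟩ := lt_iSup_iff.1 (lt_of_lt_of_le h1 hr)
    exact mem_iUnion.2 ⟨i, hi.le⟩
  have h2 := (lt_of_lt_of_le hpos (measure_mono hsub)).ne'
  rw [Ne, measure_iUnion_null_iff, not_forall] at h2
  obtain ⟨i, hi⟩ := h2
  exact ⟨i, (lt_Dstar_iff _ _ _).2 ⟨e, hde, pos_iff_ne_zero.2 hi⟩⟩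

/-- The key step: if `DstarOn > d` on a nonempty open set then it holds on a dense open set. -/
lemma key {p : ℕ} {α : ℝ} {F : Set (Euc p)} (hF : IsCompact F) (hα : 0 < α) {d : ℝ} (hd : 0 ≤ d)
    {U : Set (HolderBall p α F)} (hU : IsOpen U) (hUne : U.Nonempty)
    (h : ∀ f ∈ U, d < DstarOn (fun x : ↥F => f.1 x) univ) :
    Dense (interior {f : HolderBall p α F | d < DstarOn (fun x : ↥F => f.1 x) univ}) := by
  have : CompactSpace ↥F := isCompact_iff_compactSpace.1 hF
  rw [Metric.dense_iff]
  intro h₀ ε hε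
  -- choose the radius
  have hρ : ∃ ρ : ℝ, 0 < ρ ∧ ρ ^ α ≤ ε / 4 :=
    ⟨(ε / 4) ^ α⁻¹, by positivity, by rw [Real.rpow_inv_rpow (by positivity) hα.ne']⟩
  obtain ⟨ρ, hρ0, hρα⟩ := hρ
  obtain ⟨t, -, htf, htc⟩ := (isCompact_univ (X := ↥F)).finite_cover_balls hρ0
  have : Countable t := htf.countable
  -- localisation by Baire
  let C : Option (t × (ℕ × ℕ × ℕ)) → Set (HolderBall p α F) := fun o =>
    o.elim Uᶜ fun i => CP p α F (closedBall i.1.1 ρ) d i.2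
  have hCc : ∀ o, IsClosed (C o) := by
    rintro (_ | i)
    · exact hU.isClosed_compl
    · exact CP_closed hF isClosed_closedBall d i.2
  have hCu : ⋃ o, C o = univ := by
    rw [iUnion_eq_univ_iff]
    intro f
    by_cases hf : f ∈ U
    · obtain ⟨i, hi⟩ := Dstar_cover (fun x : ↥F => f.1 x) hd
        (fun i : t => closedBall i.1 ρ) (fun x => by
          have := htc (mem_univ x)
          simp only [mem_iUnion] at this
          obtain ⟨y, hy, hxy⟩ := this
          exact ⟨⟨y, hy⟩, ball_subset_closedBall hxy⟩) (h f hf)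
      obtain ⟨j, hj⟩ := (mem_CP hd f).1 hi
      exact ⟨some (i, j), hj⟩
    · exact ⟨none, hf⟩
  obtain ⟨f₀, hf₀U, hf₀⟩ := (dense_iUnion_interior_of_closed hCc hCu).inter_open_nonempty U hU hUne
  obtain ⟨o, ho⟩ := mem_iUnion.1 hf₀
  rcases o with _ | ⟨⟨x₀, hx₀⟩, j⟩
  · exact absurd hf₀U (interior_subset ho)
  obtain ⟨δ, hδ, hball⟩ := Metric.isOpen_iff.1 isOpen_interior f₀ ho
  have hball' : ∀ f : HolderBall p α F, dist f f₀ < δ →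
      d < DstarOn (fun x : ↥F => f.1 x) (closedBall x₀ ρ) := fun f hf =>
    (mem_CP hd f).2 ⟨j, interior_subset (hball hf)⟩
  -- transplant
  set c : ℝ := h₀.1 x₀ - f₀.1 x₀ with hc
  obtain ⟨k, hkA, hkd⟩ := exists_clamp (shift f₀ c) h₀ (A := closedBall x₀ ρ) (η := ε / 2)
    (by positivity) (by
      intro x hx
      have hx' : dist x x₀ ^ α ≤ ε / 4 :=
        (Real.rpow_le_rpow dist_nonneg hx hα.le).trans hρα
      have h1 := abs_le.1 ((f₀.2 x x₀).trans hx')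
      have h2 := abs_le.1 ((h₀.2 x x₀).trans hx')
      rw [shift_apply, abs_le]
      constructor <;> linarith [h1.1, h1.2, h2.1, h2.2])
  refine ⟨k, by rw [mem_ball]; linarith, ?_⟩
  rw [mem_interior_iff_mem_nhds, Metric.mem_nhds_iff]
  refine ⟨δ / 2, by positivity, ?_⟩
  intro f hf
  obtain ⟨g, hgA, hgd⟩ := exists_clamp (shift f (-c)) f₀ (A := closedBall x₀ ρ) (η := δ / 2)
    (by positivity) (by
      intro x hx
      have h1 : |f.1 x - k.1 x| ≤ δ / 2 :=
        (BoundedContinuousFunction.dist_coe_le_dist (f := f.1) (g := k.1) x).trans (le_of_lt hf)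
      rw [hkA x hx, shift_apply] at h1
      rw [shift_apply]
      convert h1 using 2
      ring)
  have h1 := hball' g (by linarith)
  rw [Dstar_translate _ (fun x : ↥F => f.1 x) _ (-c) (fun x hx => by
    rw [hgA x hx, shift_apply])] at h1
  exact lt_of_lt_of_le h1 (Dstar_mono _ _)

theorem stmt12 (p : ℕ) (F : Set (Euc p)) (hF : IsCompact F)
    (α : ℝ) (hα : 0 < α) (hα1 : α ≤ 1) :
    ∃ G : Set (HolderBall p α F), Dense G ∧ IsGδ G ∧
      ∀ f ∈ G, DstarOn (fun x : ↥F => f.1 x) Set.univ = DstarAlpha p α F := by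
  set S : Set ℝ := {v : ℝ | ∃ G : Set (HolderBall p α F), Dense G ∧ IsGδ G ∧
    v = sInf ((fun f : HolderBall p α F =>
      DstarOn (fun x : ↥F => f.1 x) Set.univ) '' G)} with hS
  have hDS : DstarAlpha p α F = sSup S := rfl
  have hbelow : ∀ G : Set (HolderBall p α F), BddBelow ((fun f : HolderBall p α F =>
      DstarOn (fun x : ↥F => f.1 x) Set.univ) '' G) := by
    intro G
    refine ⟨0, ?_⟩
    rintro _ ⟨f, -, rfl⟩
    exact Dstar_nonneg _ _
  have hSb : BddAbove S := by
    refine ⟨p, ?_⟩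
    rintro v ⟨G, hG, -, rfl⟩
    obtain ⟨f, hf⟩ := hG.nonempty
    exact (csInf_le (hbelow G) ⟨f, hf, rfl⟩).trans (Dstar_le _ _)
  have hS0 : sInf ((fun f : HolderBall p α F =>
      DstarOn (fun x : ↥F => f.1 x) Set.univ) '' univ) ∈ S := ⟨univ, dense_univ, IsGδ.univ, rfl⟩
  have hD0 : 0 ≤ DstarAlpha p α F := by
    rw [hDS]
    refine le_trans (Real.sInf_nonneg ?_) (le_csSup hSb hS0)
    rintro _ ⟨f, -, rfl⟩
    exact Dstar_nonneg _ _
  have hlow : ∀ n : ℕ, ∃ G : Set (HolderBall p α F), Dense G ∧ IsGδ G ∧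
      ∀ f ∈ G, DstarAlpha p α F - 1 / ((n : ℝ) + 1) < DstarOn (fun x : ↥F => f.1 x) univ := by
    intro n
    have hn : (0 : ℝ) < 1 / ((n : ℝ) + 1) := by positivity
    obtain ⟨v, ⟨G, hG, hGδ, rfl⟩, hv⟩ := exists_lt_of_lt_csSup ⟨_, hS0⟩
      (show DstarAlpha p α F - 1 / ((n : ℝ) + 1) < sSup S by rw [← hDS]; linarith)
    exact ⟨G, hG, hGδ, fun f hf => lt_of_lt_of_le hv (csInf_le (hbelow G) ⟨f, hf, rfl⟩)⟩
  have hup : ∀ n : ℕ, ∃ G : Set (HolderBall p α F), Dense G ∧ IsGδ G ∧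
      ∀ f ∈ G, DstarOn (fun x : ↥F => f.1 x) univ ≤ DstarAlpha p α F + 1 / ((n : ℝ) + 1) := by
    intro n
    have hn : (0 : ℝ) < 1 / ((n : ℝ) + 1) := by positivity
    set d := DstarAlpha p α F + 1 / ((n : ℝ) + 1) with hd
    have hd0 : 0 ≤ d := by linarith
    have hiff : ∀ f : HolderBall p α F, f ∈ ⋂ i, (CP p α F univ d i)ᶜ ↔
        DstarOn (fun x : ↥F => f.1 x) univ ≤ d := by
      intro f
      rw [← not_lt, mem_CP hd0 f]
      simp
    refine ⟨⋂ i, (CP p α F univ d i)ᶜ, ?_,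
      IsGδ.iInter fun i => (CP_closed hF isClosed_univ d i).isOpen_compl.isGδ,
      fun f hf => (hiff f).1 hf⟩
    by_contra hnd
    rw [dense_iff_inter_open] at hnd
    push Not at hnd
    obtain ⟨U, hU, hUne, hUe⟩ := hnd
    have hdense := key hF hα hd0 hU hUne (fun f hf => by
      rw [← not_le, ← hiff f]
      intro hf'
      exact (eq_empty_iff_forall_notMem.1 hUe f) ⟨hf, hf'⟩)
    have hmem : d ≤ sInf ((fun f : HolderBall p α F =>
        DstarOn (fun x : ↥F => f.1 x) Set.univ) '' (interior {f : HolderBall p α F |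
          d < DstarOn (fun x : ↥F => f.1 x) univ})) := by
      refine le_csInf (hdense.nonempty.image _) ?_
      rintro _ ⟨f, hf, rfl⟩
      have hf' : f ∈ {f : HolderBall p α F | d < DstarOn (fun x : ↥F => f.1 x) univ} :=
        interior_subset hf
      exact le_of_lt hf'
    have := hmem.trans (le_csSup hSb ⟨_, hdense, isOpen_interior.isGδ, rfl⟩)
    rw [← hDS] at this
    linarith
  choose G₁ hG₁ hG₁δ hG₁D using hlow
  choose G₂ hG₂ hG₂δ hG₂D using hup
  refine ⟨(⋂ n, G₁ n) ∩ ⋂ n, G₂ n, ?_, (IsGδ.iInter hG₁δ).inter (IsGδ.iInter hG₂δ), ?_⟩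
  · exact (dense_iInter_of_Gδ hG₁δ hG₁).inter_of_Gδ (IsGδ.iInter hG₁δ) (IsGδ.iInter hG₂δ)
      (dense_iInter_of_Gδ hG₂δ hG₂)
  · rintro f ⟨h1, h2⟩
    rw [mem_iInter] at h1 h2
    apply le_antisymm
    · refine le_of_forall_pos_le_add fun ε hε => ?_
      obtain ⟨n, hn⟩ := exists_nat_one_div_lt hε
      linarith [hG₂D n f (h2 n)]
    · refine le_of_forall_pos_le_add fun ε hε => ?_
      obtain ⟨n, hn⟩ := exists_nat_one_div_lt hε
      linarith [hG₁D n f (h1 n)]
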